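/- In the crossing-data model with a core structure whose cores are each even, let s be a component and let (P′, N′) be obtained from (P, N) by reversing the orientation of s, i.e. P′ s j = N s j, N′ s j = P s j (and symmetrically P′ j s = N j s, N′ j s = P j s) for all j ≠ s, with all other entries unchanged. Then λ̃ computed from (P, N) and λ̃′ computed from (P′, N′) (with the same core structure, noting that the mixed-crossing counts and hence π and p are unchanged) differ by an even integer: λ̃ − λ̃′ ∈ 2ℤ. -/

import Mathlib

open Finset

/-- The number of mixed classical crossings between components `i` and `j`. -/
def mCount {ι : Type*} (P N : ι → ι → ℕ) (i j : ι) : ℕ := P i j + N i j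

/-- The linking number `Lk i j = (P i j - N i j)/2`, as a complex number. -/
noncomputable def linking {ι : Type*} (P N : ι → ι → ℕ) (i j : ι) : ℂ :=
  ((P i j : ℂ) - (N i j : ℂ)) / 2

/-- The component-to-component parity `π i j = (m i j) mod 2`. -/
def ccParity {ι : Type*} (P N : ι → ι → ℕ) (i j : ι) : ℕ := (P i j + N i j) % 2

/-- The component parity function `p i j`: `0` if `i` and `j` lie in a common core,
`1` otherwise. -/
def compParity {ι : Type*} [DecidableEq ι] (cores : Finset (Finset ι)) (i j : ι) : ℕ :=
  if ∃ C ∈ cores, i ∈ C ∧ j ∈ C then 0 else 1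

/-- The modified linking number
`L̃k i j = (-1)^(p i j * (Lk i j + π i j / 2)) * Lk i j`,
where `(-1)^e` is the principal complex power (so `(-1)^(1/2) = I`). -/
noncomputable def modLinking {ι : Type*} [DecidableEq ι] (P N : ι → ι → ℕ)
    (cores : Finset (Finset ι)) (i j : ι) : ℂ :=
  (-1 : ℂ) ^ ((compParity cores i j : ℂ) *
      (linking P N i j + (ccParity P N i j : ℂ) / 2)) * linking P N i j

/-- `λ̃`: the sum over unordered pairs of distinct components of the modified
linking numbers (each unordered pair is counted twice in `offDiag`, whence the
division by `2`). -/
noncomputable def lamTilde {ι : Type*} [Fintype ι] [DecidableEq ι] (P N : ι → ι → ℕ)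
    (cores : Finset (Finset ι)) : ℂ :=
  (∑ p ∈ (univ : Finset ι).offDiag, modLinking P N cores p.1 p.2) / 2

theorem compParity_comm {ι : Type*} [DecidableEq ι] (cores : Finset (Finset ι)) (i j : ι) :
    compParity cores i j = compParity cores j i := by
  simp only [compParity, and_comm (a := i ∈ _)]

theorem modLinking_comm {ι : Type*} [DecidableEq ι] {P N : ι → ι → ℕ}
    (cores : Finset (Finset ι)) (hP : ∀ i j, P i j = P j i) (hN : ∀ i j, N i j = N j i)
    (i j : ι) : modLinking P N cores i j = modLinking P N cores j i := by
  simp only [modLinking, linking, ccParity, compParity_comm cores i j, hP i j, hN i j]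

theorem modLinking_congr {ι : Type*} [DecidableEq ι] {P N P' N' : ι → ι → ℕ}
    (cores : Finset (Finset ι)) {i j : ι} (hP : P i j = P' i j) (hN : N i j = N' i j) :
    modLinking P N cores i j = modLinking P' N' cores i j := by
  simp only [modLinking, linking, ccParity, hP, hN]

/-- Swapping the positive and negative crossings of a pair changes its modified linking number
by an integer, with the parity of the crossing count if the pair shares a core and even
otherwise. -/
theorem exists_modLinking_sub_swap {ι : Type*} [DecidableEq ι] (P N : ι → ι → ℕ)
    (cores : Finset (Finset ι)) (i j : ι) :
    ∃ e : ℤ, modLinking P N cores i j - modLinking N P cores i j = e ∧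
      (Even e ↔ Even (if ∃ C ∈ cores, i ∈ C ∧ j ∈ C then mCount P N i j else 0)) := by
  unfold modLinking compParity linking ccParity mCount
  split_ifs with h
  · refine ⟨(P i j : ℤ) - N i j, ?_, ?_⟩
    · push_cast
      simp only [zero_mul, Complex.cpow_zero]
      ring
    · simp [Int.even_sub, Nat.even_add]
  · rcases Nat.even_or_odd (P i j + N i j) with hm | hm
    · obtain ⟨n, hn⟩ : Even ((P i j : ℤ) - N i j) := by
        simpa [Int.even_sub, Nat.even_add] using hm
      have hn' : (P i j : ℂ) - N i j = n + n := by exact_mod_cast congrArg (Int.cast (R := ℂ)) hn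
      refine ⟨2 * ((-1 : ℤˣ) ^ n : ℤˣ) * n, ?_, by simp [mul_assoc]⟩
      have h1 : ((1 : ℕ) : ℂ) * (((P i j : ℂ) - N i j) / 2 + (((P i j + N i j) % 2 : ℕ) : ℂ) / 2)
          = (n : ℤ) := by
        rw [hn', Nat.even_iff.mp hm]; push_cast; ring
      have h2 : ((1 : ℕ) : ℂ) * (((N i j : ℂ) - P i j) / 2 + (((N i j + P i j) % 2 : ℕ) : ℂ) / 2)
          = (-n : ℤ) := by
        rw [← neg_sub, hn', add_comm (N i j), Nat.even_iff.mp hm]; push_cast; ring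
      rw [h1, h2, Complex.cpow_intCast, Complex.cpow_intCast, ← neg_sub (P i j : ℂ), hn']
      rcases Int.even_or_odd n with he | ho
      · rw [he.neg_one_zpow, he.neg.neg_one_zpow, he.neg_one_zpow]
        push_cast; ring
      · rw [ho.neg_one_zpow, ho.neg.neg_one_zpow, ho.neg_one_zpow]
        push_cast; ring
    · obtain ⟨n, hn⟩ : Odd ((P i j : ℤ) - N i j) := by
        have : Odd ((P i j : ℤ) + N i j) := by exact_mod_cast hm
        rw [← Int.not_even_iff_odd, Int.even_add] at this
        rwa [← Int.not_even_iff_odd, Int.even_sub]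
      have hn' : (P i j : ℂ) - N i j = 2 * n + 1 := by
        exact_mod_cast congrArg (Int.cast (R := ℂ)) hn
      refine ⟨0, ?_, by simp⟩
      have h1 : ((1 : ℕ) : ℂ) * (((P i j : ℂ) - N i j) / 2 + (((P i j + N i j) % 2 : ℕ) : ℂ) / 2)
          = (n + 1 : ℤ) := by
        rw [hn', Nat.odd_iff.mp hm]; push_cast; ring
      have h2 : ((1 : ℕ) : ℂ) * (((N i j : ℂ) - P i j) / 2 + (((N i j + P i j) % 2 : ℕ) : ℂ) / 2)
          = (-n : ℤ) := by
        rw [← neg_sub, hn', add_comm (N i j), Nat.odd_iff.mp hm]; push_cast; ring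
      rw [h1, h2, Complex.cpow_intCast, Complex.cpow_intCast, ← neg_sub (P i j : ℂ), hn']
      rcases Int.even_or_odd n with he | ho
      · rw [he.add_one.neg_one_zpow, he.neg.neg_one_zpow]
        push_cast; ring
      · rw [ho.add_one.neg_one_zpow, ho.neg.neg_one_zpow]
        push_cast; ring

theorem even_sum_mCount_commonCore {ι : Type*} [Fintype ι] [DecidableEq ι]
    (P N : ι → ι → ℕ) (cores : Finset (Finset ι))
    (hdisj : ∀ C ∈ cores, ∀ C' ∈ cores, C ≠ C' → Disjoint C C')
    (hcores : ∀ C ∈ cores, ∀ i ∈ C, Even (∑ j ∈ C, mCount P N i j)) (s : ι) :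
    Even (∑ j, if ∃ C ∈ cores, s ∈ C ∧ j ∈ C then mCount P N s j else 0) := by
  by_cases h : ∃ C ∈ cores, s ∈ C
  · obtain ⟨C, hC, hs⟩ := h
    have key : ∀ j, (∃ C ∈ cores, s ∈ C ∧ j ∈ C) ↔ j ∈ C := by
      refine fun j => ⟨?_, fun hj => ⟨C, hC, hs, hj⟩⟩
      rintro ⟨C', hC', hs', hj⟩
      by_cases hne : C' = C
      · exact hne ▸ hj
      · exact absurd hs (Finset.disjoint_left.mp (hdisj C' hC' C hC hne) hs')
    simp only [key, Finset.sum_ite_mem, Finset.univ_inter]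
    exact hcores C hC s hs
  · rw [Finset.sum_eq_zero]
    · exact Even.zero
    · intro j _
      rw [if_neg]
      rintro ⟨C, hC, hs, _⟩
      exact h ⟨C, hC, hs⟩

theorem even_sum_of_even_iff {ι : Type*} (t : Finset ι) (e : ι → ℤ) (a : ι → ℕ)
    (h : ∀ j, Even (e j) ↔ Even (a j)) (ha : Even (∑ j ∈ t, a j)) :
    Even (∑ j ∈ t, e j) := by
  have hd : Even (∑ j ∈ t, (e j - a j)) :=
    Finset.even_sum _ fun j _ => by simp [Int.even_sub, h]
  rw [Finset.sum_sub_distrib, Int.even_sub] at hd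
  exact hd.mpr (by exact_mod_cast ha)

/-- Reversing the orientation of a single component `s` (swapping `P` and `N` in all
crossings involving `s`) changes `λ̃` by an even integer. -/
theorem lamTilde_reverse_component_even {ι : Type*} [Fintype ι] [DecidableEq ι]
    (P N : ι → ι → ℕ) (cores : Finset (Finset ι))
    (hPsymm : ∀ i j, P i j = P j i) (hNsymm : ∀ i j, N i j = N j i)
    (hPdiag : ∀ i : ι, P i i = 0) (hNdiag : ∀ i : ι, N i i = 0)
    (hdisj : ∀ C ∈ cores, ∀ C' ∈ cores, C ≠ C' → Disjoint C C')
    (hcores : ∀ C ∈ cores, ∀ i ∈ C, Even (∑ j ∈ C, mCount P N i j))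
    (s : ι) :
    ∃ k : ℤ,
      lamTilde P N cores -
        lamTilde (fun i j => if i = s ∨ j = s then N i j else P i j)
                 (fun i j => if i = s ∨ j = s then P i j else N i j) cores
        = 2 * (k : ℂ) := by
  have h0 : ∀ P N : ι → ι → ℕ, P s s = 0 → N s s = 0 → modLinking P N cores s s = 0 := by
    intro P N hP hN
    simp [modLinking, linking, hP, hN]
  choose e he hpar using exists_modLinking_sub_swap P N cores s
  obtain ⟨k, hk⟩ := even_sum_of_even_iff univ e _ hpar
    (even_sum_mCount_commonCore P N cores hdisj hcores s)
  have hes : (e s : ℂ) = 0 := by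
    rw [← he s, h0 P N (hPdiag s) (hNdiag s), h0 N P (hNdiag s) (hPdiag s), sub_zero]
  have hD : ∀ i j, modLinking P N cores i j -
      modLinking (fun i j => if i = s ∨ j = s then N i j else P i j)
        (fun i j => if i = s ∨ j = s then P i j else N i j) cores i j =
      (if i = s then (e j : ℂ) else 0) + (if j = s then (e i : ℂ) else 0) := by
    intro i j
    by_cases hij : i = s ∨ j = s
    · rw [modLinking_congr (P := fun i j => if i = s ∨ j = s then N i j else P i j)
          (N := fun i j => if i = s ∨ j = s then P i j else N i j) (P' := N) (N' := P)
          cores (if_pos hij) (if_pos hij)]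
      by_cases hi : i = s
      · subst hi
        by_cases hj : j = i
        · subst hj
          simp [he, hes]
        · simp [he, hj]
      · obtain rfl := hij.resolve_left hi
        rw [modLinking_comm cores hPsymm hNsymm, modLinking_comm cores hNsymm hPsymm, he]
        simp [hi]
    · rw [modLinking_congr (P := fun i j => if i = s ∨ j = s then N i j else P i j)
          (N := fun i j => if i = s ∨ j = s then P i j else N i j) (P' := P) (N' := N)
          cores (if_neg hij) (if_neg hij)]
      rw [not_or] at hij
      simp [hij.1, hij.2]
  refine ⟨k, ?_⟩
  unfold lamTilde
  rw [← sub_div, ← Finset.sum_sub_distrib]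
  simp only [hD]
  have hoff : ∑ p ∈ (univ : Finset ι).offDiag,
      ((if p.1 = s then (e p.2 : ℂ) else 0) + (if p.2 = s then (e p.1 : ℂ) else 0)) =
      ∑ p : ι × ι,
        ((if p.1 = s then (e p.2 : ℂ) else 0) + (if p.2 = s then (e p.1 : ℂ) else 0)) := by
    refine Finset.sum_subset (Finset.subset_univ _) fun p _ hp => ?_
    have hp' : p.1 = p.2 := by simpa using hp
    rw [← hp']
    split_ifs with h
    · simp [h, hes]
    · simp
  have hk' : ∑ j, (e j : ℂ) = k + k := by exact_mod_cast congrArg (Int.cast (R := ℂ)) hk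
  rw [hoff, Finset.sum_add_distrib, Fintype.sum_prod_type_right, Fintype.sum_prod_type]
  simp only [Finset.sum_ite_eq', Finset.mem_univ, if_true, hk']
  ring
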